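/- Let p ∈ (0,1) and let η_p be a random variable on a probability space with P(η_p = 1−p) = p and P(η_p = −p) = 1−p. Then for every real λ, E exp(λ·η_p) ≤ exp(Q(p)²·λ²), i.e. η_p is subgaussian with parameter Q(p). (Upper bound part of Theorem 2.1.) -/

import Mathlib

open MeasureTheory

/-- `Q(p)²`: square of the subgaussian norm of the centered indicator with parameter `p`. -/
noncomputable def Qsq (p : ℝ) : ℝ :=
  if p = 1/2 then 1/8 else (1 - 2*p) / (4 * Real.log ((1 - p) / p))

/-- The function `x ↦ tanh x / x` is antitone on the positive half-line. -/
lemma antitoneOn_tanh_div_self : AntitoneOn (fun x : ℝ => Real.tanh x / x) (Set.Ioi 0) := by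
  have hderiv : ∀ x : ℝ, x ≠ 0 → HasDerivAt (fun x : ℝ => Real.tanh x / x)
      (((Real.cosh x * Real.cosh x - Real.sinh x * Real.sinh x) / Real.cosh x ^ 2 * x
        - Real.sinh x / Real.cosh x * 1) / x ^ 2) x := fun x hx => by
    simp only [Real.tanh_eq_sinh_div_cosh]
    exact ((Real.hasDerivAt_sinh x).div (Real.hasDerivAt_cosh x)
      (Real.cosh_pos x).ne').div (hasDerivAt_id x) hx
  refine antitoneOn_of_deriv_nonpos (convex_Ioi 0)
    (fun x hx => (hderiv x (ne_of_gt hx)).continuousAt.continuousWithinAt) ?_ ?_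
  · intro x hx
    rw [interior_Ioi] at hx
    exact (hderiv x (ne_of_gt hx)).differentiableAt.differentiableWithinAt
  · intro x hx
    rw [interior_Ioi] at hx
    have hx' : 0 < x := hx
    rw [(hderiv x hx'.ne').deriv]
    refine div_nonpos_of_nonpos_of_nonneg ?_ (sq_nonneg x)
    have hc := Real.cosh_pos x
    have hs : 2 * x ≤ Real.sinh (2 * x) := Real.self_le_sinh_iff.2 (by linarith)
    rw [Real.sinh_two_mul] at hs
    have hcs : Real.cosh x * Real.cosh x - Real.sinh x * Real.sinh x = 1 := by
      nlinarith [Real.cosh_sq x]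
    rw [hcs, show 1 / Real.cosh x ^ 2 * x - Real.sinh x / Real.cosh x * 1
      = (x - Real.sinh x * Real.cosh x) / Real.cosh x ^ 2 by field_simp]
    exact div_nonpos_of_nonpos_of_nonneg (by linarith) (sq_nonneg _)

lemma exists_log_cosh_sub_eq {a b : ℝ} (ha : 0 ≤ a) (hab : a < b) :
    ∃ c ∈ Set.Ioo a b, Real.log (Real.cosh b) - Real.log (Real.cosh a)
      = Real.tanh c / c / 2 * (b ^ 2 - a ^ 2) := by
  have hd : ∀ x, HasDerivAt (fun x => Real.log (Real.cosh x)) (Real.sinh x / Real.cosh x) x :=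
    fun x => (Real.hasDerivAt_cosh x).log (Real.cosh_pos x).ne'
  have hsq : ∀ x : ℝ, HasDerivAt (fun x : ℝ => x ^ 2) (2 * x) x := fun x => by
    simpa using hasDerivAt_pow 2 x
  obtain ⟨c, hc, h⟩ := exists_ratio_hasDerivAt_eq_ratio_slope
    (fun x => Real.log (Real.cosh x)) (fun x => Real.sinh x / Real.cosh x) hab
    (fun x _ => (hd x).continuousAt.continuousWithinAt) (fun x _ => hd x)
    (fun x => x ^ 2) (fun x => 2 * x)
    (fun x _ => (hsq x).continuousAt.continuousWithinAt) (fun x _ => hsq x)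
  have hc0 : 0 < c := ha.trans_lt hc.1
  refine ⟨c, hc, ?_⟩
  rw [Real.tanh_eq_sinh_div_cosh]
  field_simp at h ⊢
  linarith

lemma log_cosh_sub_le_of_pos {a u : ℝ} (ha : 0 < a) (hu : 0 ≤ u) :
    Real.log (Real.cosh u) - Real.log (Real.cosh a)
      ≤ Real.tanh a / a / 2 * (u ^ 2 - a ^ 2) := by
  rcases lt_trichotomy u a with h | h | h
  · obtain ⟨c, hc, e⟩ := exists_log_cosh_sub_eq hu h
    have hle := antitoneOn_tanh_div_self (hu.trans_lt hc.1 : 0 < c) ha hc.2.le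
    simp only at hle
    nlinarith [mul_nonneg (sub_nonneg.2 hle) (show 0 ≤ a ^ 2 - u ^ 2 by nlinarith)]
  · simp [h]
  · obtain ⟨c, hc, e⟩ := exists_log_cosh_sub_eq ha.le h
    have hle := antitoneOn_tanh_div_self ha (ha.trans hc.1 : 0 < c) hc.1.le
    simp only at hle
    nlinarith [mul_nonneg (sub_nonneg.2 hle) (show 0 ≤ u ^ 2 - a ^ 2 by nlinarith)]

/-- The tangent bound expressing concavity of `s ↦ log (cosh √s)`. -/
lemma log_cosh_sub_le {a : ℝ} (ha : a ≠ 0) (u : ℝ) :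
    Real.log (Real.cosh u) - Real.log (Real.cosh a)
      ≤ Real.tanh a / a / 2 * (u ^ 2 - a ^ 2) := by
  have h := log_cosh_sub_le_of_pos (abs_pos.2 ha) (abs_nonneg u)
  have ht : Real.tanh |a| / |a| = Real.tanh a / a := by
    rcases abs_choice a with h | h <;> rw [h]
    rw [Real.tanh_neg, neg_div_neg_eq]
  rwa [Real.cosh_abs, Real.cosh_abs, sq_abs, sq_abs, ht] at h

/-- The Kearns–Saul inequality. -/
lemma kearns_saul {p : ℝ} (hp : p ∈ Set.Ioo (0:ℝ) 1) (l : ℝ) :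
    p * Real.exp (l * (1 - p)) + (1 - p) * Real.exp (l * -p) ≤ Real.exp (Qsq p * l ^ 2) := by
  obtain ⟨hp0, hp1⟩ := hp
  by_cases hhalf : p = 1 / 2
  · have h := Real.cosh_le_exp_half_sq (l / 2)
    rw [Real.cosh_eq] at h
    subst hhalf
    rw [Qsq, if_pos rfl]
    convert h using 1 <;> ring_nf
  have hq0 : 0 < 1 - p := by linarith
  set a := Real.log ((1 - p) / p) / 2 with ha_def
  have hE2 : Real.exp a ^ 2 = (1 - p) / p := by
    rw [← Real.exp_nat_mul, ha_def, Nat.cast_ofNat, mul_div_cancel₀ _ two_ne_zero,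
      Real.exp_log (by positivity)]
  have hpE : p * Real.exp a ^ 2 = 1 - p := by rw [hE2]; field_simp
  have ha : a ≠ 0 := by
    intro h0
    rw [h0, Real.exp_zero] at hpE
    exact hhalf (by linarith)
  have htanh : Real.tanh a = 1 - 2 * p := by
    rw [Real.tanh_eq_sinh_div_cosh, div_eq_iff (Real.cosh_pos a).ne', Real.sinh_eq, Real.cosh_eq,
      Real.exp_neg]
    field_simp
    linarith
  have hQ : Qsq p = Real.tanh a / a / 8 := by
    rw [Qsq, if_neg hhalf, htanh, show Real.log ((1 - p) / p) = 2 * a by rw [ha_def]; ring]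
    field_simp
    ring
  have hcosh : p * Real.exp (l / 2) + (1 - p) * Real.exp (-(l / 2))
      = Real.cosh (l / 2 - a) / Real.cosh a := by
    rw [eq_div_iff (Real.cosh_pos a).ne', Real.cosh_eq, Real.cosh_eq, neg_sub, Real.exp_sub,
      Real.exp_sub, Real.exp_neg, Real.exp_neg, ← hpE]
    have h1 : p * (Real.exp a ^ 2 + 1) = 1 := by linarith
    field_simp
    linear_combination h1
  have hlhs : p * Real.exp (l * (1 - p)) + (1 - p) * Real.exp (l * -p)
      = Real.exp (l / 2 * Real.tanh a + (Real.log (Real.cosh (l / 2 - a))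
        - Real.log (Real.cosh a))) := by
    rw [Real.exp_add, Real.exp_sub, Real.exp_log (Real.cosh_pos _), Real.exp_log (Real.cosh_pos _),
      ← hcosh, htanh, mul_add, mul_left_comm, mul_left_comm _ (1 - p), ← Real.exp_add,
      ← Real.exp_add]
    ring_nf
  rw [hlhs, Real.exp_le_exp, hQ]
  refine (add_le_add_right (log_cosh_sub_le ha (l / 2 - a)) _).trans_eq ?_
  field_simp
  ring

/-- The integral of a function of a random variable taking two values almost surely. -/
lemma integral_comp_of_two_values {Ω : Type*} [MeasurableSpace Ω] {μ : Measure Ω}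
    [IsProbabilityMeasure μ] {η : Ω → ℝ} (hmeas : Measurable η) {x y p : ℝ} (hxy : x ≠ y)
    (hp : p ∈ Set.Icc (0:ℝ) 1) (hx : μ {ω | η ω = x} = ENNReal.ofReal p)
    (hy : μ {ω | η ω = y} = ENNReal.ofReal (1 - p)) (f : ℝ → ℝ) :
    ∫ ω, f (η ω) ∂μ = p * f x + (1 - p) * f y := by
  have hmx : MeasurableSet {ω | η ω = x} := hmeas (measurableSet_singleton x)
  have hmy : MeasurableSet {ω | η ω = y} := hmeas (measurableSet_singleton y)
  have hdisj : Disjoint {ω | η ω = x} {ω | η ω = y} :=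
    Set.disjoint_left.2 fun ω h h' => hxy (h.symm.trans h')
  have hunion : μ ({ω | η ω = x} ∪ {ω | η ω = y}) = 1 := by
    rw [measure_union hdisj hmy, hx, hy, ← ENNReal.ofReal_add hp.1 (sub_nonneg.2 hp.2)]
    simp
  have hae : (fun ω => f (η ω)) =ᵐ[μ] fun ω =>
      {ω | η ω = x}.indicator (fun _ => f x) ω + {ω | η ω = y}.indicator (fun _ => f y) ω := by
    filter_upwards [(mem_ae_iff_prob_eq_one (hmx.union hmy)).2 hunion] with ω hω
    rcases hω with h | h
    · have h : η ω = x := h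
      simp [h, hxy]
    · have h : η ω = y := h
      simp [h, hxy.symm]
  rw [integral_congr_ae hae, integral_add ((integrable_const _).indicator hmx)
    ((integrable_const _).indicator hmy), integral_indicator_const _ hmx,
    integral_indicator_const _ hmy, measureReal_def, measureReal_def, hx, hy,
    ENNReal.toReal_ofReal hp.1, ENNReal.toReal_ofReal (sub_nonneg.2 hp.2), smul_eq_mul,
    smul_eq_mul]

/-- Upper bound part of Theorem 2.1: the centered indicator `η_p` is subgaussian with
parameter `Q(p)`. -/
theorem centered_indicator_subgaussian
    {Ω : Type*} [MeasurableSpace Ω] (μ : Measure Ω) [IsProbabilityMeasure μ]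
    (p : ℝ) (hp : p ∈ Set.Ioo (0:ℝ) 1) (η : Ω → ℝ) (hmeas : Measurable η)
    (h1 : μ {ω | η ω = 1 - p} = ENNReal.ofReal p)
    (h2 : μ {ω | η ω = -p} = ENNReal.ofReal (1 - p)) (l : ℝ) :
    ∫ ω, Real.exp (l * η ω) ∂μ ≤ Real.exp (Qsq p * l^2) := by
  rw [integral_comp_of_two_values hmeas (by linarith) (Set.Ioo_subset_Icc_self hp) h1 h2
    fun x => Real.exp (l * x)]
  exact kearns_saul hp l
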